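/- Let p₁, p₂, p₃ ∈ ℝ² be affinely independent points forming a triangle, and suppose some vertex p_k is a regular vertex with constant c̄ ∈ (0,1], i.e. the 2×2 matrix N_k whose columns are the unit vectors (p_j − p_k)/‖p_j − p_k‖ from p_k towards the other two vertices satisfies |det N_k| ≥ c̄. Then every interior angle of the triangle is at most π − arcsin(c̄); in particular the triangle satisfies the maximum angle condition with φ̄ = π − arcsin(c̄) < π. -/

import Mathlib

open EuclideanGeometry

theorem abs_det_eq_sin_angle_mul_norm_mul_norm (x y : EuclideanSpace ℝ (Fin 2)) :
    |Matrix.det !![x 0, y 0; x 1, y 1]| =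
      Real.sin (InnerProductGeometry.angle x y) * (‖x‖ * ‖y‖) := by
  rw [InnerProductGeometry.sin_angle_mul_norm_mul_norm, ← Real.sqrt_sq_eq_abs]
  congr 1
  simp only [Matrix.det_fin_two_of, PiLp.inner_apply, Fin.sum_univ_two, RCLike.inner_apply,
    conj_trivial]
  ring

theorem abs_det_normalized_eq_sin_angle {x y : EuclideanSpace ℝ (Fin 2)}
    (hx : x ≠ 0) (hy : y ≠ 0) :
    |Matrix.det !![(‖x‖⁻¹ • x) 0, (‖y‖⁻¹ • y) 0; (‖x‖⁻¹ • x) 1, (‖y‖⁻¹ • y) 1]| =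
      Real.sin (InnerProductGeometry.angle x y) := by
  have hx' := norm_pos_iff.mpr hx
  have hy' := norm_pos_iff.mpr hy
  rw [abs_det_eq_sin_angle_mul_norm_mul_norm,
    InnerProductGeometry.angle_smul_left_of_pos _ _ (inv_pos.mpr hx'),
    InnerProductGeometry.angle_smul_right_of_pos _ _ (inv_pos.mpr hy'),
    norm_smul, norm_smul, norm_inv, norm_inv, norm_norm, norm_norm,
    inv_mul_cancel₀ hx'.ne', inv_mul_cancel₀ hy'.ne', mul_one, mul_one]

theorem Real.arcsin_le_of_le_sin {c θ : ℝ} (hθ : 0 ≤ θ) (h : c ≤ Real.sin θ) :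
    Real.arcsin c ≤ θ := by
  rcases le_total θ (Real.pi / 2) with hle | hle
  · calc Real.arcsin c ≤ Real.arcsin (Real.sin θ) := Real.monotone_arcsin h
      _ = θ := Real.arcsin_sin (by linarith [Real.pi_pos]) hle
  · exact (Real.arcsin_le_pi_div_two c).trans hle

/-- In two dimensions, the regular vertex property implies the maximum angle condition:
if the matrix of unit edge vectors emanating from the vertex `p k` has `|det| ≥ c̄ ∈ (0,1]`,
then all interior angles of the triangle are at most `π − arcsin c̄ < π`. -/
theorem stmt6 (p : Fin 3 → EuclideanSpace ℝ (Fin 2))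
    (hind : AffineIndependent ℝ p)
    (c : ℝ) (hc : c ∈ Set.Ioc (0 : ℝ) 1)
    (k j₁ j₂ : Fin 3) (hj₁ : j₁ ≠ k) (hj₂ : j₂ ≠ k) (hj : j₁ ≠ j₂)
    (hdet : c ≤
      |Matrix.det
        !![(‖p j₁ - p k‖⁻¹ • (p j₁ - p k)) 0, (‖p j₂ - p k‖⁻¹ • (p j₂ - p k)) 0;
           (‖p j₁ - p k‖⁻¹ • (p j₁ - p k)) 1, (‖p j₂ - p k‖⁻¹ • (p j₂ - p k)) 1]|) :
    (∀ i j m : Fin 3, i ≠ j → j ≠ m → i ≠ m →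
      EuclideanGeometry.angle (p i) (p j) (p m) ≤ Real.pi - Real.arcsin c) ∧
    Real.pi - Real.arcsin c < Real.pi := by
  have hinj := hind.injective
  have hsin : c ≤ Real.sin (∠ (p j₁) (p k) (p j₂)) := by
    rwa [abs_det_normalized_eq_sin_angle (sub_ne_zero.mpr (hinj.ne hj₁))
      (sub_ne_zero.mpr (hinj.ne hj₂))] at hdet
  have key : ∀ a b : Fin 3, a ≠ k → b ≠ k → a ≠ b →
      Real.arcsin c ≤ ∠ (p a) (p k) (p b) ∧
        ∠ (p a) (p k) (p b) ≤ Real.pi - Real.arcsin c := by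
    intro a b ha hb hab
    have hs : c ≤ Real.sin (∠ (p a) (p k) (p b)) := by
      obtain ⟨rfl, rfl⟩ | ⟨rfl, rfl⟩ : (a = j₁ ∧ b = j₂) ∨ (a = j₂ ∧ b = j₁) := by omega
      · exact hsin
      · rwa [EuclideanGeometry.angle_comm]
    refine ⟨Real.arcsin_le_of_le_sin (EuclideanGeometry.angle_nonneg _ _ _) hs, ?_⟩
    have := Real.arcsin_le_of_le_sin (sub_nonneg.mpr (EuclideanGeometry.angle_le_pi _ _ _))
      ((Real.sin_pi_sub _).symm ▸ hs)
    linarith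
  refine ⟨fun i j m hij hjm him => ?_, sub_lt_self _ (Real.arcsin_pos.mpr hc.1)⟩
  have hsum := EuclideanGeometry.angle_add_angle_add_angle_eq_pi (p m) (hinj.ne hij.symm)
  have hi := EuclideanGeometry.angle_nonneg (p m) (p i) (p j)
  have hm := EuclideanGeometry.angle_nonneg (p j) (p m) (p i)
  obtain rfl | rfl | rfl : j = k ∨ i = k ∨ m = k := by omega
  · exact (key i m hij hjm.symm him).2
  · linarith [(key m j him.symm hij.symm hjm.symm).1]
  · linarith [(key j i hjm him hij.symm).1]
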